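/- Let F = (V_0,…,V_k) be a partial flag of type d in V and let 𝔭_F = {x ∈ End(V) : tr(x) = 0 and x(V_p) ⊆ V_p for all p}. Let 𝔦 ⊆ 𝔭_F be a linear subspace with [𝔭_F, 𝔦] ⊆ 𝔦. Then there exists a nondecreasing sequence of integers c = (c_0 ≤ c_1 ≤ ⋯ ≤ c_k) with 0 ≤ c_p ≤ p for all p, such that for every nilpotent endomorphism x of V one has: x ∈ 𝔦 if and only if x(V_p) ⊆ V_{c_p} for all p = 0,…,k. -/

import Mathlib

open Module Submodule

theorem aux_matrix {ι : Type*} [Fintype ι] [DecidableEq ι] (k : ℕ) (lev : ι → Fin (k+1))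
    (hlev : ∀ s, lev s ≠ 0) (J : Submodule ℂ (Matrix ι ι ℂ))
    (hP : ∀ x ∈ J, ∀ s t, x s t ≠ 0 → lev s ≤ lev t)
    (hI : ∀ y : Matrix ι ι ℂ, (∀ s t, y s t ≠ 0 → lev s ≤ lev t) → ∀ x ∈ J, y * x - x * y ∈ J) :
    ∃ c : Fin (k+1) → Fin (k+1), Monotone c ∧ (∀ p, c p ≤ p) ∧
      ∀ x : Matrix ι ι ℂ, IsNilpotent x →
        (x ∈ J ↔ ∀ s t, x s t ≠ 0 → lev s ≤ c (lev t)) := by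
  classical
  set E : ι → ι → Matrix ι ι ℂ := fun s t => Matrix.single s t 1 with hE
  have EP : ∀ a b, lev a ≤ lev b → ∀ s t, E a b s t ≠ 0 → lev s ≤ lev t := by
    intro a b hab s t h
    simp only [hE, Matrix.single_apply, ne_eq, ite_eq_right_iff, not_forall] at h
    obtain ⟨⟨rfl, rfl⟩, -⟩ := h
    exact hab
  have EE : ∀ a b c, E a b * E b c = E a c := by
    intro a b c; simp [hE]
  have EZ : ∀ a b c d, b ≠ c → E a b * E c d = 0 := by
    intro a b c d h; simp [hE, h]
  have EJ : ∀ s t, E s t ∈ J → lev s ≤ lev t := by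
    intro s t h
    exact hP _ h s t (by simp [hE])
  -- extraction
  have ext1 : ∀ x ∈ J, ∀ s t, s ≠ t → x s t ≠ 0 → E s t ∈ J := by
    intro x hx s t hst hne
    have h1 := hI _ (EP s s le_rfl) x hx
    have h2 := hI _ (EP t t le_rfl) _ h1
    have h3 := hI _ (EP s s le_rfl) _ h2
    have h4 : x s t • E s t ∈ J := by
      have h5 : x s t • E s t = (-(1/2:ℂ)) • (
          (E t t * (E s s * x - x * E s s) - (E s s * x - x * E s s) * E t t)
          + (E s s * (E t t * (E s s * x - x * E s s) - (E s s * x - x * E s s) * E t t)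
            - (E t t * (E s s * x - x * E s s) - (E s s * x - x * E s s) * E t t) * E s s)) := by
        have e1 : E s s * E t t = 0 := EZ _ _ _ _ hst
        have e2 : E t t * E s s = 0 := EZ _ _ _ _ hst.symm
        have e3 : E s s * E s s = E s s := EE _ _ _
        have e4 : E s s * x * E t t = x s t • E s t := by
          simp [hE, Matrix.single_mul_mul_single, Matrix.smul_single]
        have a1 : E t t * (E s s * x - x * E s s) - (E s s * x - x * E s s) * E t t
            = - (E t t * x * E s s) - E s s * x * E t t := by
          have : E t t * (E s s * x - x * E s s) - (E s s * x - x * E s s) * E t t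
            = (E t t * E s s) * x - E t t * x * E s s - E s s * x * E t t
              + x * (E s s * E t t) := by noncomm_ring
          rw [this, e1, e2]; simp
        have a2 : E s s * (- (E t t * x * E s s) - E s s * x * E t t)
            - (- (E t t * x * E s s) - E s s * x * E t t) * E s s
            = E t t * x * E s s - E s s * x * E t t := by
          have : E s s * (- (E t t * x * E s s) - E s s * x * E t t)
            - (- (E t t * x * E s s) - E s s * x * E t t) * E s s
            = - ((E s s * E t t) * x * E s s) - (E s s * E s s) * x * E t t
              + E t t * x * (E s s * E s s) + E s s * x * (E t t * E s s) := by noncomm_ring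
          rw [this, e1, e2, e3]; simp; abel
        rw [a1, a2, e4]
        module
      rw [h5]
      exact J.smul_mem _ (J.add_mem h2 h3)
    exact (J.smul_mem_iff hne).1 h4
  have left : ∀ s' s t, E s t ∈ J → s' ≠ t → lev s' ≤ lev s → E s' t ∈ J := by
    intro s' s t h hne hl
    have := hI _ (EP s' s hl) _ h
    rwa [EE, EZ _ _ _ _ hne.symm, sub_zero] at this
  have right : ∀ s t t', E s t ∈ J → s ≠ t' → lev t ≤ lev t' → E s t' ∈ J := by
    intro s t t' h hne hl
    have := hI _ (EP t t' hl) _ h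
    rw [EE, EZ _ _ _ _ hne.symm, zero_sub] at this
    exact (J.neg_mem_iff).1 this
  have diag : ∀ s t, E s t ∈ J → lev t ≤ lev s → E s s - E t t ∈ J := by
    intro s t h hl
    have := hI _ (EP t s hl) _ h
    rw [EE, EE] at this
    rw [← neg_sub]; exact J.neg_mem this
  have flip : ∀ s t, s ≠ t → E t s ∈ J → lev s ≤ lev t → E s t ∈ J := by
    intro s t hne h hl
    have h1 := diag t s h hl
    have h2 := hI _ (EP s t hl) _ h1
    have : E s t * (E t t - E s s) - (E t t - E s s) * E s t = (2:ℂ) • E s t := by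
      rw [mul_sub, sub_mul, EE, EE, EZ _ _ _ _ hne.symm, EZ _ _ _ _ hne.symm]
      module
    rw [this] at h2
    exact (J.smul_mem_iff two_ne_zero).1 h2
  let c : Fin (k+1) → Fin (k+1) := fun p =>
    (Finset.univ.filter (fun a : ι × ι => a.1 ≠ a.2 ∧ E a.1 a.2 ∈ J ∧ lev a.2 ≤ p)).sup
      (fun a => lev a.1)
  have hc1 : ∀ p s t, s ≠ t → E s t ∈ J → lev t ≤ p → lev s ≤ c p := by
    intro p s t h1 h2 h3
    exact Finset.le_sup (f := fun a : ι × ι => lev a.1) (b := (s, t)) (by simp [h1, h2, h3])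
  have hc2 : ∀ p s, lev s ≤ c p → ∃ s' t', s' ≠ t' ∧ E s' t' ∈ J ∧ lev t' ≤ p ∧ lev s ≤ lev s' := by
    intro p s h
    rw [Finset.le_sup_iff (Fin.pos_iff_ne_zero.2 (hlev s))] at h
    obtain ⟨⟨a, b⟩, h1, h2⟩ := h
    simp only [Finset.mem_filter, Finset.mem_univ, true_and] at h1
    exact ⟨a, b, h1.1, h1.2.1, h1.2.2, h2⟩
  have off : ∀ s t, s ≠ t → lev s ≤ c (lev t) → E s t ∈ J := by
    intro s t hst h
    obtain ⟨s', t', hne, hJ, h1, h2⟩ := hc2 _ _ h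
    by_cases e : s = t'
    · by_cases e' : t = s'
      · subst e e'
        exact flip _ _ hst hJ h2
      · have := right s' t' t hJ (Ne.symm e') h1
        exact left _ _ _ this hst h2
    · have := left s s' t' hJ e h2
      exact right _ _ _ this hst h1
  refine ⟨c, ?_, ?_, ?_⟩
  · intro p q hpq
    refine Finset.sup_mono ?_
    intro a ha
    simp only [Finset.mem_filter, Finset.mem_univ, true_and] at ha ⊢
    exact ⟨ha.1, ha.2.1, ha.2.2.trans hpq⟩
  · intro p
    refine Finset.sup_le ?_
    intro a ha
    simp only [Finset.mem_filter, Finset.mem_univ, true_and] at ha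
    exact (EJ _ _ ha.2.1).trans ha.2.2
  intro x hx
  constructor
  · intro hxJ s t hne
    by_cases hst : s = t
    · subst hst
      by_contra hlt
      push Not at hlt
      have hcol : ∀ r, r ≠ s → x r s ≠ 0 → lev r < lev s := fun r hr h =>
        (hc1 _ r s hr (ext1 x hxJ r s hr h) le_rfl).trans_lt hlt
      have key : ∀ m : ℕ, (x ^ m) s s = (x s s) ^ m ∧
          ∀ r, r ≠ s → (x ^ m) r s ≠ 0 → lev r < lev s := by
        intro m
        induction m with
        | zero => simp +contextual [Matrix.one_apply]
        | succ m ih =>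
          have ih2 : ∀ r, r ≠ s → lev s ≤ lev r → (x ^ m) r s = 0 := by
            intro r hr hl
            by_contra h
            exact absurd (ih.2 r hr h) (not_lt.2 hl)
          constructor
          · rw [pow_succ', Matrix.mul_apply, Finset.sum_eq_single s, ih.1, pow_succ']
            · intro r _ hr
              by_cases h : x s r = 0
              · simp [h]
              · rw [ih2 r hr (hP x hxJ _ _ h), mul_zero]
            · simp
          · intro r hr h
            rw [pow_succ', Matrix.mul_apply] at h
            obtain ⟨u, -, hu⟩ := Finset.exists_ne_zero_of_sum_ne_zero h
            have h1 := left_ne_zero_of_mul hu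
            have h2 := right_ne_zero_of_mul hu
            by_cases hus : u = s
            · subst hus; exact hcol r hr h1
            · exact (hP x hxJ _ _ h1).trans_lt (ih.2 u hus h2)
      obtain ⟨m, hm⟩ := hx
      have := (key m).1
      rw [hm] at this
      exact pow_ne_zero m hne (by simpa using this.symm)
    · exact hc1 _ s t hst (ext1 x hxJ s t hst hne) le_rfl
  · intro h
    have hcle : ∀ p, c p ≤ p := by
      intro p
      refine Finset.sup_le ?_
      intro a ha
      simp only [Finset.mem_filter, Finset.mem_univ, true_and] at ha
      exact (EJ _ _ ha.2.1).trans ha.2.2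
    have hxP : ∀ s t, x s t ≠ 0 → lev s ≤ lev t := fun s t hh => (h s t hh).trans (hcle _)
    -- traces
    have tr : ∀ Q : ι → Prop, (∀ s t, lev s ≤ lev t → Q t → Q s) →
        ∑ t, (if Q t then x t t else 0) = 0 := by
      intro Q hQ
      let π : Matrix ι ι ℂ := Matrix.diagonal (fun t => if Q t then 1 else 0)
      have h1 : π * (x * π) = x * π := by
        ext s t
        simp only [π, Matrix.diagonal_mul, Matrix.mul_diagonal]
        by_cases hx0 : x s t = 0
        · simp [hx0]
        · by_cases hq : Q t
          · simp [hq, hQ s t (hxP _ _ hx0) hq]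
          · simp [hq]
      have h2 : ∀ m : ℕ, (x * π) ^ (m+1) = x ^ (m+1) * π := by
        intro m
        induction m with
        | zero => simp
        | succ m ih => rw [pow_succ, ih, mul_assoc, h1, ← mul_assoc, ← pow_succ]
      have h3 : IsNilpotent (x * π) := by
        obtain ⟨m, hm⟩ := hx
        refine ⟨m+1, ?_⟩
        rw [h2, pow_succ, hm]; simp
      have h4 := (Matrix.isNilpotent_trace_of_isNilpotent h3).eq_zero
      simpa [Matrix.trace, π, Matrix.mul_diagonal] using h4
    have trq : ∀ q, ∑ t, (if lev t = q then x t t else 0) = 0 := by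
      intro q
      have a := tr (fun t => lev t ≤ q) (fun s t h1 h2 => h1.trans h2)
      have b := tr (fun t => lev t < q) (fun s t h1 h2 => h1.trans_lt h2)
      refine Eq.trans ?_ (sub_eq_zero.2 (a.trans b.symm))
      rw [← Finset.sum_sub_distrib]
      refine Finset.sum_congr rfl fun t _ => ?_
      rcases lt_trichotomy (lev t) q with h | h | h
      · simp [h, h.le, h.ne]
      · simp [h]
      · simp [h.not_ge, h.not_gt, h.ne']
    have dg : ∀ q, ∑ t, (if lev t = q then x t t • E t t else 0) ∈ J := by
      intro q
      by_cases hz : ∃ t, lev t = q ∧ x t t ≠ 0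
      · obtain ⟨t₀, hq, hne⟩ := hz
        have hcq := h _ _ hne
        have hz : ∑ t, (if lev t = q then x t t • E t t else 0)
            = ∑ t, (if lev t = q then x t t • (E t t - E t₀ t₀) else 0) := by
          have : ∑ t, (if lev t = q then x t t • E t t else 0)
            - ∑ t, (if lev t = q then x t t • (E t t - E t₀ t₀) else 0) =
            (∑ t, (if lev t = q then x t t else 0)) • E t₀ t₀ := by
            rw [← Finset.sum_sub_distrib, Finset.sum_smul]
            refine Finset.sum_congr rfl fun t _ => ?_
            split_ifs
            · module
            · simp
          rw [trq, zero_smul] at this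
          exact sub_eq_zero.1 this
        rw [hz]
        refine J.sum_mem fun t _ => ?_
        split_ifs with ht
        · refine J.smul_mem _ ?_
          by_cases e : t = t₀
          · simp [e]
          · refine diag _ _ (off _ _ e ?_) ?_
            · rw [ht, ← hq]; exact hcq
            · rw [ht, hq]
        · exact J.zero_mem
      · push Not at hz
        refine J.sum_mem fun t _ => ?_
        split_ifs with ht
        · rw [hz t ht, zero_smul]; exact J.zero_mem
        · exact J.zero_mem
    have dg' : ∑ t, x t t • E t t ∈ J := by
      have : ∑ t, x t t • E t t = ∑ q, ∑ t, (if lev t = q then x t t • E t t else 0) := by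
        rw [Finset.sum_comm]; simp
      rw [this]
      exact J.sum_mem fun q _ => dg q
    have hxs : x = ∑ t, x t t • E t t + ∑ s, ∑ t, (if s = t then 0 else x s t • E s t) := by
      conv_lhs => rw [Matrix.matrix_eq_sum_single x]
      rw [← Finset.sum_add_distrib]
      refine Finset.sum_congr rfl fun s _ => ?_
      rw [← Finset.add_sum_erase _ _ (Finset.mem_univ s),
        ← Finset.add_sum_erase _ (fun t => if s = t then 0 else x s t • E s t) (Finset.mem_univ s)]
      simp only [if_true, zero_add]
      congr 1
      · simp [hE, Matrix.smul_single]
      · refine Finset.sum_congr rfl fun t ht => ?_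
        rw [if_neg (Finset.ne_of_mem_erase ht).symm]
        simp [hE, Matrix.smul_single]
    rw [hxs]
    refine J.add_mem dg' (J.sum_mem fun s _ => J.sum_mem fun t _ => ?_)
    split_ifs with e
    · exact J.zero_mem
    · by_cases h0 : x s t = 0
      · rw [h0, zero_smul]; exact J.zero_mem
      · exact J.smul_mem _ (off s t e (h s t h0))

theorem aux_basis {V : Type*} [AddCommGroup V] [Module ℂ V] (k : ℕ)
    (F : Fin (k + 1) → Submodule ℂ V) (hFmono : Monotone F) (m : Fin (k+1)) :
    ∃ B : Set V, LinearIndepOn ℂ id B ∧ B ⊆ F m ∧ ∀ p ≤ m, F p ≤ span ℂ (B ∩ F p) := by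
  induction m using Fin.induction with
  | zero =>
    obtain ⟨b, hb, -, h2, h3⟩ := exists_linearIndepOn_id_extension
      (linearIndepOn_empty ℂ (id : V → V)) (Set.empty_subset (F 0 : Set V))
    refine ⟨b, h3, hb, ?_⟩
    intro p hp
    obtain rfl : p = 0 := Fin.le_zero_iff.1 hp
    rw [Set.inter_eq_left.2 hb]
    exact h2
  | succ i ih =>
    obtain ⟨B, h1, h2, h3⟩ := ih
    obtain ⟨b, hb, hB, g2, g3⟩ := exists_linearIndepOn_id_extension
      h1 (h2.trans (hFmono (Fin.castSucc_lt_succ (i := i)).le))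
    refine ⟨b, g3, hb, ?_⟩
    intro p hp
    rcases hp.eq_or_lt with rfl | hlt
    · rw [Set.inter_eq_left.2 hb]
      exact g2
    · exact (h3 p (Fin.le_castSucc_iff.2 hlt)).trans (span_mono (Set.inter_subset_inter_left _ hB))

theorem stmt_8 (V : Type*) [AddCommGroup V] [Module ℂ V] [FiniteDimensional ℂ V]
    (n k : ℕ) (hdimV : finrank ℂ V = n)
    (d : Fin (k + 1) → ℕ) (hd0 : d 0 = 0) (hdlast : d (Fin.last k) = n) (hdsm : StrictMono d)
    (F : Fin (k + 1) → Submodule ℂ V) (hFmono : Monotone F)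
    (hFdim : ∀ p, finrank ℂ (F p) = d p)
    (I : Submodule ℂ (Module.End ℂ V))
    (hIp : ∀ x ∈ I, LinearMap.trace ℂ V x = 0 ∧ ∀ p, (F p).map x ≤ F p)
    (hIdeal : ∀ y : Module.End ℂ V, LinearMap.trace ℂ V y = 0 →
      (∀ p, (F p).map y ≤ F p) → ∀ x ∈ I, y * x - x * y ∈ I) :
    ∃ c : Fin (k + 1) → Fin (k + 1), Monotone c ∧ (∀ p, c p ≤ p) ∧
      ∀ x : Module.End ℂ V, IsNilpotent x →
        (x ∈ I ↔ ∀ p, (F p).map x ≤ F (c p)) := by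
  classical
  have hIdeal' : ∀ y : Module.End ℂ V, (∀ p, (F p).map y ≤ F p) → ∀ x ∈ I, y * x - x * y ∈ I := by
    intro y hy x hx
    by_cases hn : n = 0
    · have : Subsingleton V := finrank_zero_iff.1 (hdimV.trans hn)
      have : y * x - x * y = 0 := by ext v; exact Subsingleton.elim _ _
      rw [this]; exact I.zero_mem
    · set a : ℂ := LinearMap.trace ℂ V y / n with ha
      have h := hIdeal (y - a • 1) ?_ ?_ x hx
      · have e : (y - a • 1) * x - x * (y - a • 1) = y * x - x * y := by
          simp [sub_mul, mul_sub]
        rwa [e] at h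
      · have : (n:ℂ) ≠ 0 := by exact_mod_cast hn
        simp [LinearMap.trace_one, hdimV, ha, this]
      · intro p
        rintro _ ⟨v, hv, rfl⟩
        have := hy p (Submodule.mem_map_of_mem hv)
        simpa using (F p).sub_mem this ((F p).smul_mem a hv)
  have hbot : F 0 = ⊥ := by
    rw [← Submodule.finrank_eq_zero, hFdim, hd0]
  have htop : F (Fin.last k) = ⊤ := Submodule.eq_top_of_finrank_eq (by rw [hFdim, hdlast, hdimV])
  obtain ⟨B, hB1, -, hB3⟩ := aux_basis k F hFmono (Fin.last k)
  have hspan : ⊤ ≤ span ℂ (Set.range ((↑) : B → V)) := by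
    rw [Subtype.range_coe, ← htop]
    exact (hB3 _ le_rfl).trans (span_mono Set.inter_subset_left)
  let b : Basis B ℂ V := Basis.mk (v := ((↑) : B → V)) hB1 hspan
  have hb : ∀ s : B, b s = (s : V) := fun s => Basis.mk_apply hB1 hspan s
  have : Fintype B := FiniteDimensional.fintypeBasisIndex b
  have hex : ∀ s : B, ∃ p, (∀ q, p ≤ q ↔ b s ∈ F q) := by
    intro s
    have hne : (Finset.univ.filter (fun q => b s ∈ F q)).Nonempty :=
      ⟨Fin.last k, by simp [htop]⟩
    refine ⟨(Finset.univ.filter (fun q => b s ∈ F q)).min' hne, fun q => ⟨fun h => ?_, fun h => ?_⟩⟩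
    · have := Finset.min'_mem _ hne
      simp only [Finset.mem_filter, Finset.mem_univ, true_and] at this
      exact hFmono h this
    · exact Finset.min'_le _ _ (by simp [h])
  choose lev hlev using hex
  have hlev0 : ∀ s, lev s ≠ 0 := by
    intro s h
    have h1 := (hlev s 0).1 h.le
    rw [hbot, Submodule.mem_bot] at h1
    exact b.ne_zero s h1
  have hF : ∀ p, F p = span ℂ (b '' {s | lev s ≤ p}) := by
    intro p
    apply le_antisymm
    · refine (hB3 p (Fin.le_last p)).trans (span_mono ?_)
      rintro v ⟨hv, hvp⟩
      exact ⟨⟨v, hv⟩, (hlev _ p).2 (by rw [hb]; exact hvp), hb _⟩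
    · rw [span_le]
      rintro _ ⟨s, hs, rfl⟩
      exact (hlev s p).1 hs
  have hmem : ∀ p v, v ∈ F p ↔ ∀ s, b.repr v s ≠ 0 → lev s ≤ p := by
    intro p v
    rw [hF, Basis.mem_span_image]
    simp [Set.subset_def]
  have hmap : ∀ (x : Module.End ℂ V) (p q), (F p).map x ≤ F q ↔
      ∀ s t, LinearMap.toMatrix b b x s t ≠ 0 → lev t ≤ p → lev s ≤ q := by
    intro x p q
    constructor
    · intro h s t hne ht
      have := h (Submodule.mem_map_of_mem ((hlev t p).1 ht))
      rw [hmem] at this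
      exact this s (by rwa [LinearMap.toMatrix_apply] at hne)
    · intro h
      rw [hF p, Submodule.map_span, span_le]
      rintro _ ⟨_, ⟨t, ht, rfl⟩, rfl⟩
      rw [SetLike.mem_coe, hmem]
      intro s hs
      exact h s t (by rwa [LinearMap.toMatrix_apply]) ht
  let e := LinearMap.toMatrixAlgEquiv b
  have he : ∀ x, e x = LinearMap.toMatrix b b x := fun x => rfl
  have hmem2 : ∀ y, y ∈ I.map (e.toLinearEquiv : Module.End ℂ V →ₗ[ℂ] Matrix B B ℂ) ↔ e.symm y ∈ I := by
    intro y
    constructor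
    · rintro ⟨x, hx, rfl⟩
      simpa using hx
    · intro h
      exact ⟨_, h, by simp⟩
  obtain ⟨c, hc1, hc2, hc3⟩ := aux_matrix k lev hlev0
    (I.map (e.toLinearEquiv : Module.End ℂ V →ₗ[ℂ] Matrix B B ℂ)) (by
      intro x hx s t hne
      rw [hmem2] at hx
      refine (hmap (e.symm x) (lev t) (lev t)).1 ((hIp _ hx).2 _) s t ?_ le_rfl
      rw [← he]; simpa using hne) (by
      intro y hy x hx
      rw [hmem2] at hx ⊢
      rw [map_sub, map_mul, map_mul]
      refine hIdeal' _ ?_ _ hx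
      intro p
      rw [hmap]
      intro s t hne ht
      rw [← he] at hne
      exact (hy s t (by simpa using hne)).trans ht)
  refine ⟨c, hc1, hc2, ?_⟩
  intro x hx
  have h1 := hc3 (e x) (hx.map e)
  rw [hmem2, AlgEquiv.symm_apply_apply] at h1
  rw [h1]
  constructor
  · intro h p
    rw [hmap]
    intro s t hne ht
    exact (h s t hne).trans (hc1 ht)
  · intro h s t hne
    exact (hmap _ _ _).1 (h (lev t)) s t hne le_rfl
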